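/- arXiv:math/9908163 — 2 statements merged into one kernel-verified Lean document; each statement's English description precedes it below -/
import Mathlib

section
/- For all nonnegative integers i, j with j ≤ i, any real α, β and real x, one has ∑_{k=j}^{i} P_{i-k}^{(-α-2,\,-β-i+k)}(x) · P_{k-j}^{(α,\,β-k+j)}(x) = δ_{ij} (Kronecker delta). -/
/-- The Jacobi polynomial with arbitrary real parameters `α`, `β`:
`P_n^{(α,β)}(x) = ∑_{k=0}^{n} (n+α+β+1)_k/k! · (α+k+1)_{n-k}/(n-k)! · ((x-1)/2)^k`. -/
noncomputable def jacobi (α β : ℝ) (n : ℕ) (x : ℝ) : ℝ :=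
  ∑ k ∈ Finset.range (n + 1),
    ((ascPochhammer ℝ k).eval ((n : ℝ) + α + β + 1) / (Nat.factorial k)) *
      ((ascPochhammer ℝ (n - k)).eval (α + k + 1) / (Nat.factorial (n - k))) *
      ((x - 1) / 2) ^ k

open Finset in
/-- A nested sum over pairs of antidiagonals is invariant under exchanging the inner components. -/
theorem sum_antidiagonal_antidiagonal_exchange {M : Type*} [AddCommMonoid M] (N : ℕ)
    (f : ℕ → ℕ → ℕ → ℕ → M) :
    ∑ u ∈ antidiagonal N, ∑ v ∈ antidiagonal u.1, ∑ w ∈ antidiagonal u.2,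
        f v.1 v.2 w.1 w.2 =
      ∑ u ∈ antidiagonal N, ∑ v ∈ antidiagonal u.1, ∑ w ∈ antidiagonal u.2,
        f v.1 w.1 v.2 w.2 := by
  simp only [sum_sigma']
  refine sum_nbij'
    (fun z => ⟨(z.2.1.1 + z.2.2.1, z.2.1.2 + z.2.2.2), ⟨(z.2.1.1, z.2.2.1), (z.2.1.2, z.2.2.2)⟩⟩)
    (fun z => ⟨(z.2.1.1 + z.2.2.1, z.2.1.2 + z.2.2.2), ⟨(z.2.1.1, z.2.2.1), (z.2.1.2, z.2.2.2)⟩⟩)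
    ?_ ?_ ?_ ?_ ?_
  · rintro ⟨⟨a, b⟩, ⟨⟨c, d⟩, ⟨e, g⟩⟩⟩ h
    simp only [mem_sigma, HasAntidiagonal.mem_antidiagonal] at h ⊢
    grind
  · rintro ⟨⟨a, b⟩, ⟨⟨c, d⟩, ⟨e, g⟩⟩⟩ h
    simp only [mem_sigma, HasAntidiagonal.mem_antidiagonal] at h ⊢
    grind
  · rintro ⟨⟨a, b⟩, ⟨⟨c, d⟩, ⟨e, g⟩⟩⟩ h
    simp only [mem_sigma, HasAntidiagonal.mem_antidiagonal] at h
    obtain ⟨_, rfl, rfl⟩ := h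
    rfl
  · rintro ⟨⟨a, b⟩, ⟨⟨c, d⟩, ⟨e, g⟩⟩⟩ h
    simp only [mem_sigma, HasAntidiagonal.mem_antidiagonal] at h
    obtain ⟨_, rfl, rfl⟩ := h
    rfl
  · intros
    rfl

/-- The Chu–Vandermonde identity for `Ring.multichoose`. -/
theorem multichoose_add_eq_sum_antidiagonal {R : Type*} [CommRing R] [BinomialRing R]
    (r s : R) (n : ℕ) :
    Ring.multichoose (r + s) n =
      ∑ p ∈ Finset.HasAntidiagonal.antidiagonal n,
        Ring.multichoose r p.1 * Ring.multichoose s p.2 := by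
  have key (t : R) (m : ℕ) :
      Ring.multichoose t m = (m : ℤ).negOnePow • Ring.choose (-t) m := by
    rw [Ring.choose_neg', smul_smul, ← Int.negOnePow_add, Int.negOnePow_even _ ⟨_, rfl⟩, one_smul]
  rw [key, neg_add, Ring.add_choose_eq n (Commute.all _ _), Finset.smul_sum]
  refine Finset.sum_congr rfl fun p hp => ?_
  rw [key r, key s, smul_mul_smul_comm, ← Int.negOnePow_add, ← Nat.cast_add,
    Finset.HasAntidiagonal.mem_antidiagonal.mp hp]

theorem ascPochhammer_eval_div_factorial (r : ℝ) (n : ℕ) :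
    (ascPochhammer ℝ n).eval r / n.factorial = Ring.multichoose r n := by
  rw [div_eq_iff (by positivity), mul_comm, ← nsmul_eq_mul,
    Ring.factorial_nsmul_multichoose_eq_ascPochhammer, Polynomial.ascPochhammer_smeval_eq_eval]

/-- The coefficient of `t ^ n` in `(1 - t) ^ (-a) * (1 - y * t / (1 - t)) ^ (-c)`. -/
noncomputable def jacobiCoeff (a c y : ℝ) (n : ℕ) : ℝ :=
  ∑ p ∈ Finset.HasAntidiagonal.antidiagonal n,
    Ring.multichoose c p.1 * Ring.multichoose (a + p.1) p.2 * y ^ p.1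

theorem jacobi_eq_jacobiCoeff (α β x : ℝ) (n : ℕ) :
    jacobi α β n x = jacobiCoeff (α + 1) (n + α + β + 1) ((x - 1) / 2) n := by
  rw [jacobiCoeff, Finset.Nat.sum_antidiagonal_eq_sum_range_succ_mk, jacobi]
  refine Finset.sum_congr rfl fun k _ => ?_
  rw [ascPochhammer_eval_div_factorial, ascPochhammer_eval_div_factorial, add_right_comm α]

theorem sum_jacobiCoeff_mul_jacobiCoeff (a b c d y : ℝ) (n : ℕ) :
    ∑ p ∈ Finset.HasAntidiagonal.antidiagonal n, jacobiCoeff a c y p.1 * jacobiCoeff b d y p.2 =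
      jacobiCoeff (a + b) (c + d) y n := by
  simp only [jacobiCoeff, Finset.sum_mul_sum]
  rw [sum_antidiagonal_antidiagonal_exchange n fun k p l q =>
    Ring.multichoose c k * Ring.multichoose (a + k) p * y ^ k *
      (Ring.multichoose d l * Ring.multichoose (b + l) q * y ^ l)]
  refine Finset.sum_congr rfl fun u _ => ?_
  rw [multichoose_add_eq_sum_antidiagonal c d, Finset.sum_mul, Finset.sum_mul]
  refine Finset.sum_congr rfl fun v hv => ?_
  have hv' : (u.1 : ℝ) = v.1 + v.2 := by
    exact_mod_cast (Finset.HasAntidiagonal.mem_antidiagonal.mp hv).symm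
  rw [show a + b + (u.1 : ℝ) = (a + v.1) + (b + v.2) by rw [hv']; ring,
    multichoose_add_eq_sum_antidiagonal, Finset.mul_sum, Finset.sum_mul]
  refine Finset.sum_congr rfl fun w _ => ?_
  rw [← Finset.HasAntidiagonal.mem_antidiagonal.mp hv, pow_add]
  ring

theorem jacobiCoeff_zero_zero (y : ℝ) (n : ℕ) :
    jacobiCoeff 0 0 y n = if n = 0 then 1 else 0 := by
  cases n with
  | zero => simp [jacobiCoeff]
  | succ n =>
    simp [jacobiCoeff, Finset.Nat.sum_antidiagonal_succ, Ring.multichoose_zero_succ]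

/-- Inversion formula coming from the Meixner polynomials:
`∑_{k=j}^{i} P_{i-k}^{(-α-2, -β-i+k)}(x) P_{k-j}^{(α, β-k+j)}(x) = δ_{ij}`. -/
theorem jacobi_meixner_inversion (α β : ℝ) (i j : ℕ) (hij : j ≤ i) (x : ℝ) :
    ∑ k ∈ Finset.Icc j i,
        jacobi (-α - 2) (-β - i + k) (i - k) x * jacobi α (β - k + j) (k - j) x =
      if i = j then 1 else 0 := by
  obtain ⟨n, rfl⟩ := Nat.exists_eq_add_of_le hij
  have hsum := sum_jacobiCoeff_mul_jacobiCoeff (-α - 1) (α + 1) (-(α + β + 1)) (α + β + 1)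
    ((x - 1) / 2) n
  rw [show -α - 1 + (α + 1) = 0 by ring, neg_add_cancel, jacobiCoeff_zero_zero,
    ← Finset.Nat.sum_antidiagonal_swap, Finset.Nat.sum_antidiagonal_eq_sum_range_succ_mk] at hsum
  rw [← Finset.Ico_succ_right_eq_Icc, Finset.sum_Ico_eq_sum_range]
  simp only [Nat.add_eq_left]
  rw [← hsum]
  refine Finset.sum_congr (by congr 1; simp; omega) fun k hk => ?_
  obtain ⟨m, rfl⟩ := Nat.exists_eq_add_of_le (Nat.lt_succ_iff.mp (Finset.mem_range.mp hk))
  rw [jacobi_eq_jacobiCoeff, jacobi_eq_jacobiCoeff]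
  simp only [Prod.swap, Nat.add_sub_cancel_left, ← Nat.add_assoc]
  push_cast
  congr 2 <;> ring
end

section
/- Let α be a real number that is not an integer. Then for all nonnegative integers i, j with j ≤ i and all real x, one has ∑_{k=j}^{i} [(-2α-1)_{i-k}/(-α)_{i-k}] · [(2α+1)_{k-j}/(α+1)_{k-j}] · P_{i-k}^{(-α-1,-α-1)}(x) · P_{k-j}^{(α,α)}(x) = δ_{ij} (Kronecker delta). -/
/-- The coefficient of `((x - 1) / 2) ^ k` in the `n`-th ultraspherical polynomial
with parameter `α + 1 / 2`. -/
noncomputable def ultrasphericalCoeff (α : ℝ) (n k : ℕ) : ℝ :=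
  if k ≤ n then
    (ascPochhammer ℝ (n + k)).eval (2 * α + 1) /
      ((ascPochhammer ℝ k).eval (α + 1) * k.factorial * (n - k).factorial)
  else 0

/-- The ultraspherical polynomial of degree `n` with parameter `α + 1 / 2`,
as a multiple of a Jacobi polynomial. -/
noncomputable def ultraspherical (α : ℝ) (n : ℕ) (x : ℝ) : ℝ :=
  (ascPochhammer ℝ n).eval (2 * α + 1) / (ascPochhammer ℝ n).eval (α + 1) * jacobi α α n x

theorem ascPochhammer_eval_add (a : ℝ) (m n : ℕ) :
    (ascPochhammer ℝ (m + n)).eval a =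
      (ascPochhammer ℝ m).eval a * (ascPochhammer ℝ n).eval (a + m) := by
  rw [← ascPochhammer_mul]
  simp

theorem ascPochhammer_eval_ne_zero {a : ℝ} (ha : ∀ k : ℕ, a + k ≠ 0) (n : ℕ) :
    (ascPochhammer ℝ n).eval a ≠ 0 := by
  induction n with
  | zero => simp
  | succ n ih => rw [ascPochhammer_succ_eval]; exact mul_ne_zero ih (ha n)

theorem ultraspherical_eq_sum {α : ℝ} (hα : ∀ k : ℕ, α + 1 + k ≠ 0) (x : ℝ) {n N : ℕ}
    (hN : n < N) :
    ultraspherical α n x =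
      ∑ k ∈ Finset.range N, ultrasphericalCoeff α n k * ((x - 1) / 2) ^ k := by
  have hsub : Finset.range (n + 1) ⊆ Finset.range N := Finset.range_subset_range.2 hN
  rw [← Finset.sum_subset hsub, ultraspherical, jacobi, Finset.mul_sum]
  · refine Finset.sum_congr rfl fun k hk => ?_
    have hk : k ≤ n := Nat.lt_succ_iff.1 (Finset.mem_range.1 hk)
    rw [ultrasphericalCoeff, if_pos hk, ascPochhammer_eval_add]
    have hsplit := ascPochhammer_eval_add (α + 1) k (n - k)
    rw [Nat.add_sub_cancel' hk] at hsplit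
    have h₁ := ascPochhammer_eval_ne_zero hα n
    have h₂ := ascPochhammer_eval_ne_zero hα k
    have e₁ : (n : ℝ) + α + α + 1 = 2 * α + 1 + n := by ring
    have e₂ : α + k + 1 = α + 1 + k := by ring
    rw [e₁, e₂]
    rw [hsplit] at h₁ ⊢
    have h₃ := right_ne_zero_of_mul h₁
    field_simp
  · intro k _ hk
    have hk : ¬ k ≤ n := by simpa [Nat.lt_succ_iff] using hk
    rw [ultrasphericalCoeff, if_neg hk, zero_mul]

theorem ultrasphericalCoeff_zero_rec (α : ℝ) (n : ℕ) :
    (n + 2) * ultrasphericalCoeff α (n + 2) 0 =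
      (2 * n + 2 * α + 3) * ultrasphericalCoeff α (n + 1) 0 -
        (n + 2 * α + 1) * ultrasphericalCoeff α n 0 := by
  simp only [ultrasphericalCoeff, Nat.zero_le, if_true, add_zero, Nat.sub_zero,
    ascPochhammer_succ_eval, Nat.factorial_succ, ascPochhammer_zero, Polynomial.eval_one]
  push_cast
  have h := Nat.cast_ne_zero (R := ℝ).2 n.factorial_ne_zero
  field_simp
  ring

theorem ultrasphericalCoeff_succ_rec {α : ℝ} (hα : ∀ k : ℕ, α + 1 + k ≠ 0) (n k : ℕ) :
    (n + 2) * ultrasphericalCoeff α (n + 2) (k + 1) =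
      (2 * n + 2 * α + 3) *
          (ultrasphericalCoeff α (n + 1) (k + 1) + 2 * ultrasphericalCoeff α (n + 1) k) -
        (n + 2 * α + 1) * ultrasphericalCoeff α n (k + 1) := by
  have hP := ascPochhammer_eval_ne_zero hα k
  have hk := hα k
  have hf := Nat.cast_ne_zero (R := ℝ).2 k.factorial_ne_zero
  have hshift (a : ℕ) :
      (ascPochhammer ℝ (a + 1)).eval (2 * α + 1) =
        (ascPochhammer ℝ a).eval (2 * α + 1) * (2 * α + 1 + a) := ascPochhammer_succ_eval _ _
  have e₃ : n + 2 + (k + 1) = n + k + 1 + 1 + 1 := by ring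
  have e₂ : n + 1 + (k + 1) = n + k + 1 + 1 := by ring
  have e₁ : n + 1 + k = n + k + 1 := by ring
  have e₀ : n + (k + 1) = n + k + 1 := by ring
  simp only [ultrasphericalCoeff, e₃, e₂, e₁, e₀, hshift (n + k + 1 + 1), hshift (n + k + 1)]
  generalize (ascPochhammer ℝ (n + k + 1)).eval (2 * α + 1) = Q
  rw [ascPochhammer_succ_eval, Nat.factorial_succ k]
  rcases lt_trichotomy k n with h | rfl | h
  · obtain ⟨m, rfl⟩ := Nat.exists_eq_add_of_lt h
    have s₂ : k + m + 1 + 2 - (k + 1) = m + 1 + 1 := by omega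
    have s₁ : k + m + 1 + 1 - (k + 1) = m + 1 := by omega
    have s₁' : k + m + 1 + 1 - k = m + 1 + 1 := by omega
    have s₀ : k + m + 1 - (k + 1) = m := by omega
    rw [if_pos (by omega), if_pos (by omega), if_pos (by omega), if_pos (by omega),
      s₂, s₁, s₁', s₀]
    simp only [Nat.factorial_succ]
    push_cast
    have hm := Nat.cast_ne_zero (R := ℝ).2 m.factorial_ne_zero
    field_simp
    ring
  · have s₂ : k + 2 - (k + 1) = 1 := by omega
    have s₁ : k + 1 - k = 1 := by omega
    rw [if_pos (by omega), if_pos (by omega), if_pos (by omega), if_neg (by omega), s₂, s₁,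
      Nat.sub_self]
    simp only [Nat.factorial_one, Nat.factorial_zero]
    push_cast
    field_simp
    ring
  · rcases Nat.lt_or_ge (n + 1) k with h' | h'
    · rw [if_neg (by omega), if_neg (by omega), if_neg (by omega), if_neg (by omega)]
      ring
    · obtain rfl : k = n + 1 := by omega
      rw [if_pos (by omega), if_neg (by omega), if_pos (by omega), if_neg (by omega),
        Nat.sub_self, Nat.sub_self]
      push_cast at hk ⊢
      simp only [Nat.factorial_zero]
      field_simp
      ring

theorem ultraspherical_rec {α : ℝ} (hα : ∀ k : ℕ, α + 1 + k ≠ 0) (x : ℝ) (n : ℕ) :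
    (n + 2) * ultraspherical α (n + 2) x =
      (2 * n + 2 * α + 3) * x * ultraspherical α (n + 1) x -
        (n + 2 * α + 1) * ultraspherical α n x := by
  have hmul : (x - 1) / 2 * ultraspherical α (n + 1) x =
      ∑ k ∈ Finset.range (n + 2),
        ultrasphericalCoeff α (n + 1) k * ((x - 1) / 2) ^ (k + 1) := by
    rw [ultraspherical_eq_sum hα x (N := n + 2) (by omega), Finset.mul_sum]
    exact Finset.sum_congr rfl fun k _ => by ring
  have hx : (2 * n + 2 * α + 3) * x * ultraspherical α (n + 1) x =
      (2 * n + 2 * α + 3) *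
        (ultraspherical α (n + 1) x + 2 * ((x - 1) / 2 * ultraspherical α (n + 1) x)) := by
    ring
  rw [hx, hmul, ultraspherical_eq_sum hα x (n := n + 2) (N := n + 2 + 1) (by omega),
    ultraspherical_eq_sum hα x (n := n + 1) (N := n + 2 + 1) (by omega),
    ultraspherical_eq_sum hα x (n := n) (N := n + 2 + 1) (by omega)]
  simp only [Finset.sum_range_succ' _ (n + 2), pow_zero, mul_one]
  have hsum : (n + 2) * ∑ k ∈ Finset.range (n + 2),
        ultrasphericalCoeff α (n + 2) (k + 1) * ((x - 1) / 2) ^ (k + 1) =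
      (2 * n + 2 * α + 3) *
          (∑ k ∈ Finset.range (n + 2),
              ultrasphericalCoeff α (n + 1) (k + 1) * ((x - 1) / 2) ^ (k + 1) +
            2 * ∑ k ∈ Finset.range (n + 2),
              ultrasphericalCoeff α (n + 1) k * ((x - 1) / 2) ^ (k + 1)) -
        (n + 2 * α + 1) * ∑ k ∈ Finset.range (n + 2),
          ultrasphericalCoeff α n (k + 1) * ((x - 1) / 2) ^ (k + 1) := by
    simp only [Finset.mul_sum, ← Finset.sum_add_distrib, ← Finset.sum_sub_distrib]
    refine Finset.sum_congr rfl fun k _ => ?_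
    linear_combination ((x - 1) / 2) ^ (k + 1) * ultrasphericalCoeff_succ_rec hα n k
  linear_combination hsum + ultrasphericalCoeff_zero_rec α n

theorem ultraspherical_zero (α x : ℝ) : ultraspherical α 0 x = 1 := by
  simp [ultraspherical, jacobi]

theorem ultraspherical_one {α : ℝ} (hα : ∀ k : ℕ, α + 1 + k ≠ 0) (x : ℝ) :
    ultraspherical α 1 x = (2 * α + 1) * x := by
  have h : α + 1 ≠ 0 := by simpa using hα 0
  simp [ultraspherical, jacobi, Finset.sum_range_succ]
  field_simp
  ring

open PowerSeries in
theorem derivative_mk_ultraspherical {α : ℝ} (hα : ∀ k : ℕ, α + 1 + k ≠ 0) (x : ℝ) :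
    (1 - C (2 * x) * X + X * X) * d⁄dX ℝ (mk fun n => ultraspherical α n x) =
      C (2 * α + 1) * (C x - X) * mk fun n => ultraspherical α n x := by
  ext n
  simp only [add_mul, sub_mul, mul_sub, one_mul, mul_assoc, map_add, map_sub, coeff_C_mul]
  rcases n with _ | _ | n
  · simp [coeff_zero_X_mul, coeff_derivative, ultraspherical_zero, ultraspherical_one hα]
    ring
  · simp only [coeff_succ_X_mul, coeff_zero_X_mul, coeff_derivative, coeff_mk]
    have h := ultraspherical_rec hα x 0
    push_cast at h ⊢
    linear_combination h
  · simp only [coeff_succ_X_mul, coeff_derivative, coeff_mk]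
    have h := ultraspherical_rec hα x (n + 1)
    push_cast at h ⊢
    linear_combination h

open PowerSeries in
theorem mk_ultraspherical_mul {α : ℝ} (hα : ∀ m : ℤ, α ≠ m) (x : ℝ) :
    (mk fun n => ultraspherical (-α - 1) n x) * (mk fun n => ultraspherical α n x) = 1 := by
  have hpos : ∀ k : ℕ, α + 1 + k ≠ 0 := fun k h => hα (-1 - k) (by push_cast; linarith)
  have hneg : ∀ k : ℕ, -α - 1 + 1 + k ≠ 0 := fun k h => hα k (by push_cast; linarith)
  have hF := derivative_mk_ultraspherical hneg x
  have hG := derivative_mk_ultraspherical hpos x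
  have hD : (1 - C (2 * x) * X + X * X : PowerSeries ℝ) ≠ 0 := fun h => by
    simpa using congrArg constantCoeff h
  have hC : (C (2 * (-α - 1) + 1) : PowerSeries ℝ) = -C (2 * α + 1) := by
    rw [← map_neg]; ring_nf
  rw [hC] at hF
  refine PowerSeries.derivative.ext (mul_left_cancel₀ hD ?_) ?_
  · rw [Derivation.leibniz, Derivation.map_one_eq_zero, smul_eq_mul, smul_eq_mul]
    linear_combination (mk fun n => ultraspherical (-α - 1) n x) * hG +
      (mk fun n => ultraspherical α n x) * hF
  · simp [← coeff_zero_eq_constantCoeff_apply, coeff_mul, ultraspherical_zero]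

/-- Inversion formula coming from the ultraspherical polynomials: if `α` is not an
integer, then `∑_{k=j}^{i} (-2α-1)_{i-k}/(-α)_{i-k} · (2α+1)_{k-j}/(α+1)_{k-j} ·
P_{i-k}^{(-α-1,-α-1)}(x) P_{k-j}^{(α,α)}(x) = δ_{ij}`. -/
theorem jacobi_ultraspherical_inversion (α : ℝ) (hα : ∀ m : ℤ, α ≠ m)
    (i j : ℕ) (hij : j ≤ i) (x : ℝ) :
    ∑ k ∈ Finset.Icc j i,
        ((ascPochhammer ℝ (i - k)).eval (-2 * α - 1) / (ascPochhammer ℝ (i - k)).eval (-α)) *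
          ((ascPochhammer ℝ (k - j)).eval (2 * α + 1) / (ascPochhammer ℝ (k - j)).eval (α + 1)) *
          jacobi (-α - 1) (-α - 1) (i - k) x * jacobi α α (k - j) x =
      if i = j then 1 else 0 := by
  have h := congrArg (PowerSeries.coeff (i - j)) (mk_ultraspherical_mul hα x)
  rw [mul_comm, PowerSeries.coeff_mul, Finset.Nat.sum_antidiagonal_eq_sum_range_succ_mk,
    PowerSeries.coeff_one] at h
  have hdelta : (i - j = 0) ↔ i = j := by omega
  simp only [PowerSeries.coeff_mk, hdelta] at h
  rw [← h, ← Finset.Ico_add_one_right_eq_Icc, Finset.sum_Ico_eq_sum_range,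
    show i + 1 - j = (i - j).succ by omega]
  refine Finset.sum_congr rfl fun k _ => ?_
  have e₁ : 2 * (-α - 1) + 1 = -2 * α - 1 := by ring
  have e₂ : -α - 1 + 1 = -α := by ring
  rw [ultraspherical, ultraspherical, e₁, e₂, Nat.add_sub_cancel_left, Nat.sub_add_eq]
  ring
end
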